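/- Let p, b ∈ (0,1), and for a positive integer n set S(n) = Σ_{k=0}^{⌊bn⌋} C(n,k)·p^k·(1−p)^{n−k} and T(n) = Σ_{k=0}^{⌊bn⌋} k·C(n,k)·p^k·(1−p)^{n−k}. Then: (i) if b > p there exist C, c > 0 such that 1 − S(n) ≤ C·e^{−cn} and |T(n) − np| ≤ C·e^{−cn} for all n; (ii) if b = p there exist C > 0 and N such that |S(n) − 1/2| ≤ C/√n and |T(n) − np/2| ≤ C·√n for all n > N; (iii) if b < p there exist C, c > 0 such that S(n) ≤ C·e^{−cn} and T(n) ≤ C·e^{−cn} for all n. -/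

import Mathlib

/-- `S(n) = Pr(S_n ≤ bn)` for `S_n ∼ Bin(n,p)`. -/
noncomputable def binCdf (p b : ℝ) (n : ℕ) : ℝ :=
  ∑ k ∈ Finset.range (⌊b * n⌋₊ + 1), (n.choose k : ℝ) * p ^ k * (1 - p) ^ (n - k)

/-- `T(n) = E[S_n · 1{S_n ≤ bn}]` for `S_n ∼ Bin(n,p)`. -/
noncomputable def binPartialMean (p b : ℝ) (n : ℕ) : ℝ :=
  ∑ k ∈ Finset.range (⌊b * n⌋₊ + 1),
    (k : ℝ) * ((n.choose k : ℝ) * p ^ k * (1 - p) ^ (n - k))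

open Finset Real MeasureTheory

/-- The mass that the binomial distribution `Bin(n,p)` gives to `k`. -/
noncomputable def binWeight (p : ℝ) (n k : ℕ) : ℝ :=
  (n.choose k : ℝ) * p ^ k * (1 - p) ^ (n - k)

lemma binWeight_nonneg {p : ℝ} (hp : p ∈ Set.Ioo (0 : ℝ) 1) (n k : ℕ) : 0 ≤ binWeight p n k := by
  have h0 := hp.1.le
  have h1 : 0 ≤ 1 - p := by linarith [hp.2]
  unfold binWeight
  positivity

lemma sum_binWeight_mul_pow (p y : ℝ) (n : ℕ) :
    ∑ k ∈ range (n + 1), binWeight p n k * y ^ k = (1 - p + p * y) ^ n := by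
  rw [add_comm (1 - p), add_pow]
  refine sum_congr rfl fun k _ => ?_
  rw [binWeight, mul_pow]
  ring

lemma sum_binWeight (p : ℝ) (n : ℕ) : ∑ k ∈ range (n + 1), binWeight p n k = 1 := by
  simpa using sum_binWeight_mul_pow p 1 n

/-- The Stein identity of the binomial distribution. -/
lemma binWeight_stein (p : ℝ) (n : ℕ) (F : ℕ → ℝ) :
    ∑ k ∈ range (n + 1), binWeight p n k * (p * (n - k) * (F (k + 1) - F k)) =
      ∑ k ∈ range (n + 1), binWeight p n k * ((k - n * p) * F k) := by
  have shift : ∑ k ∈ range (n + 1), binWeight p n k * (p * (n - k)) * F (k + 1) =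
      ∑ k ∈ range (n + 1), binWeight p n k * ((1 - p) * k) * F k := by
    rw [sum_range_succ, sum_range_succ']
    simp only [sub_self, mul_zero, zero_mul, add_zero, Nat.cast_zero]
    refine sum_congr rfl fun k hk => ?_
    have hk' : k < n := mem_range.1 hk
    have hc : (n.choose (k + 1) : ℝ) * (k + 1) = n.choose k * (n - k) := by
      have := Nat.choose_succ_right_eq n k
      rw [← Nat.cast_sub hk'.le]
      exact_mod_cast this
    have hpow : (1 - p) ^ (n - k) = (1 - p) ^ (n - (k + 1)) * (1 - p) := by
      rw [← pow_succ]
      congr 1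
      omega
    simp only [binWeight, hpow, Nat.cast_add, Nat.cast_one]
    linear_combination (-(p ^ (k + 1) * (1 - p) ^ (n - (k + 1)) * (1 - p) * F (k + 1))) * hc
  rw [← sub_eq_zero] at shift ⊢
  rw [← shift, ← sum_sub_distrib, ← sum_sub_distrib]
  refine sum_congr rfl fun k _ => ?_
  ring

lemma sum_binWeight_mul_sub (p : ℝ) (n : ℕ) :
    ∑ k ∈ range (n + 1), binWeight p n k * (k - n * p) = 0 := by
  simpa using (binWeight_stein p n fun _ => 1).symm

lemma sum_binWeight_mul_id (p : ℝ) (n : ℕ) :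
    ∑ k ∈ range (n + 1), binWeight p n k * k = n * p := by
  have h := sum_binWeight_mul_sub p n
  simp only [mul_sub, sum_sub_distrib, ← sum_mul, sum_binWeight] at h
  linarith

lemma sum_binWeight_mul_sub_sq (p : ℝ) (n : ℕ) :
    ∑ k ∈ range (n + 1), binWeight p n k * (k - n * p) ^ 2 = n * p * (1 - p) := by
  have h := binWeight_stein p n fun k => k
  have h0 := sum_binWeight_mul_sub p n
  have e : ∀ k : ℕ, binWeight p n k * (k - n * p) ^ 2 =
      binWeight p n k * ((k - n * p) * k) - n * p * (binWeight p n k * (k - n * p)) := by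
    intro k; ring
  have e' : ∀ k : ℕ, binWeight p n k * (p * (n - k) * (((k + 1 : ℕ) : ℝ) - k)) =
      n * p * binWeight p n k - p * (binWeight p n k * k) := by
    intro k; push_cast; ring
  simp only [e'] at h
  simp only [e]
  rw [sum_sub_distrib, ← mul_sum, h0, ← h, sum_sub_distrib, ← mul_sum, ← mul_sum, sum_binWeight,
    sum_binWeight_mul_id]
  ring

lemma sum_binWeight_mul_abs_sub_le {p : ℝ} (hp : p ∈ Set.Ioo (0 : ℝ) 1) {n : ℕ} :
    ∑ k ∈ range (n + 1), binWeight p n k * |(k : ℝ) - n * p| ≤ √(n * p * (1 - p)) := by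
  refine Real.le_sqrt_of_sq_le ?_
  have h := sum_sq_le_sum_mul_sum_of_sq_le_mul (range (n + 1))
    (r := fun k : ℕ => binWeight p n k * |(k : ℝ) - n * p|) (f := binWeight p n)
    (g := fun k : ℕ => binWeight p n k * ((k : ℝ) - n * p) ^ 2)
    (fun k _ => binWeight_nonneg hp n k)
    (fun k _ => mul_nonneg (binWeight_nonneg hp n k) (sq_nonneg _))
    (fun k _ => le_of_eq (by rw [mul_pow, sq_abs]; ring))
  rwa [sum_binWeight, one_mul, sum_binWeight_mul_sub_sq] at h

lemma sum_range_floor_succ {x : ℝ} (hx : 0 ≤ x) {n : ℕ} (hxn : x ≤ n) (a : ℕ → ℝ) :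
    ∑ k ∈ range (⌊x⌋₊ + 1), a k = ∑ k ∈ range (n + 1), if (k : ℝ) ≤ x then a k else 0 := by
  rw [← sum_filter]
  refine sum_congr ?_ fun _ _ => rfl
  ext k
  simp only [mem_range, mem_filter, Nat.lt_succ_iff, Nat.le_floor_iff hx]
  refine ⟨fun h => ⟨?_, h⟩, fun h => h.2⟩
  exact_mod_cast h.trans hxn

lemma mul_natCast_mem_Icc {b : ℝ} (hb : b ∈ Set.Ioo (0 : ℝ) 1) (n : ℕ) :
    b * n ∈ Set.Icc (0 : ℝ) n :=
  ⟨mul_nonneg hb.1.le n.cast_nonneg, mul_le_of_le_one_left n.cast_nonneg hb.2.le⟩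

lemma binCdf_eq {b : ℝ} (hb : b ∈ Set.Ioo (0 : ℝ) 1) (p : ℝ) (n : ℕ) :
    binCdf p b n = ∑ k ∈ range (n + 1), if (k : ℝ) ≤ b * n then binWeight p n k else 0 :=
  sum_range_floor_succ (mul_natCast_mem_Icc hb n).1 (mul_natCast_mem_Icc hb n).2 _

lemma binPartialMean_eq {b : ℝ} (hb : b ∈ Set.Ioo (0 : ℝ) 1) (p : ℝ) (n : ℕ) :
    binPartialMean p b n =
      ∑ k ∈ range (n + 1), if (k : ℝ) ≤ b * n then k * binWeight p n k else 0 :=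
  sum_range_floor_succ (mul_natCast_mem_Icc hb n).1 (mul_natCast_mem_Icc hb n).2 _

lemma one_sub_binCdf_eq {b : ℝ} (hb : b ∈ Set.Ioo (0 : ℝ) 1) (p : ℝ) (n : ℕ) :
    1 - binCdf p b n = ∑ k ∈ range (n + 1), if (k : ℝ) ≤ b * n then 0 else binWeight p n k := by
  rw [binCdf_eq hb, ← sum_binWeight p n, ← sum_sub_distrib]
  refine sum_congr rfl fun k _ => ?_
  split_ifs <;> ring

lemma sub_binPartialMean_eq {b : ℝ} (hb : b ∈ Set.Ioo (0 : ℝ) 1) (p : ℝ) (n : ℕ) :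
    n * p - binPartialMean p b n =
      ∑ k ∈ range (n + 1), if (k : ℝ) ≤ b * n then 0 else k * binWeight p n k := by
  rw [binPartialMean_eq hb, ← sum_binWeight_mul_id p n, ← sum_sub_distrib]
  refine sum_congr rfl fun k _ => ?_
  split_ifs <;> ring

/-- A Chernoff bound for the moment generating function, at a convenient parameter. -/
lemma sum_binWeight_mul_exp_le {p b : ℝ} (hp : p ∈ Set.Ioo (0 : ℝ) 1) (hb : b ∈ Set.Ioo (0 : ℝ) 1)
    (n : ℕ) :
    ∑ k ∈ range (n + 1), binWeight p n k * exp ((b - p) / 2 * (k - b * n)) ≤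
      exp (-((b - p) ^ 2 / 4) * n) := by
  obtain ⟨hp0, hp1⟩ := hp
  obtain ⟨hb0, hb1⟩ := hb
  set t := (b - p) / 2 with ht
  have ht1 : |t| ≤ 1 := by rw [abs_le]; constructor <;> linarith
  have quad : ∀ u : ℝ, |u| ≤ 1 → exp (t * u) ≤ 1 + t * u + t ^ 2 := by
    intro u hu
    have h1 : |t * u| ≤ 1 := by
      rw [abs_mul]; exact mul_le_one₀ ht1 (abs_nonneg _) hu
    have h2 := (abs_le.1 (Real.abs_exp_sub_one_sub_id_le h1)).2
    have h3 : u ^ 2 ≤ 1 := (sq_le_one_iff_abs_le_one u).2 hu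
    nlinarith [mul_le_mul_of_nonneg_left h3 (sq_nonneg t)]
  have hq := quad (-b) (by rw [abs_le]; constructor <;> linarith)
  have hq' := quad (1 - b) (by rw [abs_le]; constructor <;> linarith)
  have base : (1 - p + p * exp t) * exp (t * -b) ≤ exp (-((b - p) ^ 2 / 4)) := by
    have h1 : (1 - p + p * exp t) * exp (t * -b) =
        (1 - p) * exp (t * -b) + p * exp (t * (1 - b)) := by
      rw [show t * (1 - b) = t + t * -b by ring, Real.exp_add]; ring
    have h2 := Real.add_one_le_exp (-((b - p) ^ 2 / 4))
    rw [h1]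
    refine le_trans ?_ h2
    have h3 := mul_le_mul_of_nonneg_left hq (by linarith : 0 ≤ 1 - p)
    have h4 := mul_le_mul_of_nonneg_left hq' hp0.le
    have h5 : t ^ 2 = (b - p) ^ 2 / 4 := by rw [ht]; ring
    have h6 : t * (p - b) = -((b - p) ^ 2 / 2) := by rw [ht]; ring
    linarith
  have hsum : ∑ k ∈ range (n + 1), binWeight p n k * exp (t * (k - b * n)) =
      ((1 - p + p * exp t) * exp (t * -b)) ^ n := by
    rw [mul_pow, ← sum_binWeight_mul_pow, sum_mul]
    refine sum_congr rfl fun k _ => ?_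
    rw [mul_assoc, ← Real.exp_nat_mul, ← Real.exp_nat_mul, ← Real.exp_add]
    ring_nf
  rw [hsum, mul_comm _ (n : ℝ), Real.exp_nat_mul]
  have : 0 ≤ 1 - p := by linarith
  exact pow_le_pow_left₀ (by positivity) base n

lemma one_sub_binCdf_le {p b : ℝ} (hp : p ∈ Set.Ioo (0 : ℝ) 1) (hb : b ∈ Set.Ioo (0 : ℝ) 1)
    (h : p < b) (n : ℕ) : 1 - binCdf p b n ≤ exp (-((b - p) ^ 2 / 4) * n) := by
  rw [one_sub_binCdf_eq hb]
  refine (sum_le_sum fun k _ => ?_).trans (sum_binWeight_mul_exp_le hp hb n)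
  have hw := binWeight_nonneg hp n k
  split_ifs with hk
  · positivity
  · exact le_mul_of_one_le_right hw (Real.one_le_exp (mul_nonneg (by linarith) (by linarith)))

lemma binCdf_le {p b : ℝ} (hp : p ∈ Set.Ioo (0 : ℝ) 1) (hb : b ∈ Set.Ioo (0 : ℝ) 1)
    (h : b < p) (n : ℕ) : binCdf p b n ≤ exp (-((b - p) ^ 2 / 4) * n) := by
  rw [binCdf_eq hb]
  refine (sum_le_sum fun k _ => ?_).trans (sum_binWeight_mul_exp_le hp hb n)
  have hw := binWeight_nonneg hp n k
  split_ifs with hk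
  · exact le_mul_of_one_le_right hw
      (Real.one_le_exp (mul_nonneg_of_nonpos_of_nonpos (by linarith) (by linarith)))
  · positivity

lemma abs_binPartialMean_sub_le {p b : ℝ} (hp : p ∈ Set.Ioo (0 : ℝ) 1)
    (hb : b ∈ Set.Ioo (0 : ℝ) 1) (n : ℕ) :
    |binPartialMean p b n - n * p| ≤ n * (1 - binCdf p b n) := by
  rw [abs_sub_comm, sub_binPartialMean_eq hb, one_sub_binCdf_eq hb, mul_sum]
  refine (abs_sum_le_sum_abs _ _).trans (sum_le_sum fun k hk => ?_)
  have hw := binWeight_nonneg hp n k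
  have hkn : (k : ℝ) ≤ n := by exact_mod_cast Nat.lt_succ_iff.1 (mem_range.1 hk)
  split_ifs
  · simp
  · rw [abs_of_nonneg (by positivity)]
    gcongr

lemma binPartialMean_le {p b : ℝ} (hp : p ∈ Set.Ioo (0 : ℝ) 1) (hb : b ∈ Set.Ioo (0 : ℝ) 1)
    (n : ℕ) : binPartialMean p b n ≤ n * binCdf p b n := by
  rw [binPartialMean_eq hb, binCdf_eq hb, mul_sum]
  refine sum_le_sum fun k hk => ?_
  have hw := binWeight_nonneg hp n k
  have hkn : (k : ℝ) ≤ n := by exact_mod_cast Nat.lt_succ_iff.1 (mem_range.1 hk)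
  split_ifs
  · gcongr
  · simp

/-- A quantity with exponential decay keeps it, at half the rate, after multiplication by `n`. -/
lemma exp_decay_half {c : ℝ} (hc : 0 < c) {n : ℕ} {u v : ℝ} (hu : u ≤ exp (-c * n))
    (hv : v ≤ n * u) :
    u ≤ (1 + 2 / c) * exp (-(c / 2) * n) ∧ v ≤ (1 + 2 / c) * exp (-(c / 2) * n) := by
  have hsplit : exp (-c * n) = exp (-(c / 2) * n) * exp (-(c / 2) * n) := by
    rw [← Real.exp_add]; ring_nf
  have hle : exp (-(c / 2) * n) ≤ 1 :=
    Real.exp_le_one_iff.2 (by have := mul_nonneg hc.le n.cast_nonneg (α := ℝ); linarith)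
  have hn : n * exp (-(c / 2) * n) ≤ 2 / c := by
    have h1 := Real.add_one_le_exp (c / 2 * n)
    rw [neg_mul, Real.exp_neg, ← div_eq_mul_inv, div_le_div_iff₀ (Real.exp_pos _) hc]
    linarith
  have hpos := Real.exp_pos (-(c / 2) * n)
  have hc' : 0 < 2 / c := by positivity
  rw [hsplit] at hu
  constructor
  · nlinarith
  · have := mul_le_mul_of_nonneg_left hu n.cast_nonneg (α := ℝ)
    nlinarith

/-- The Mills ratio of the standard normal law. -/
noncomputable def mills (w : ℝ) : ℝ := ∫ t in Set.Ioi (0 : ℝ), exp (-w * t - t ^ 2 / 2)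

lemma integrableOn_pow_mul_mills {w : ℝ} (hw : 0 ≤ w) (j : ℕ) :
    IntegrableOn (fun t : ℝ => t ^ j * exp (-w * t - t ^ 2 / 2)) (Set.Ioi 0) := by
  have h : Integrable (fun t : ℝ => t ^ j * exp (-(1 / 2) * t ^ 2)) := by
    have := integrable_rpow_mul_exp_neg_mul_sq (b := 1 / 2) (by norm_num) (s := j)
      (by have := j.cast_nonneg (α := ℝ); linarith)
    simpa using this
  refine Integrable.mono' h.integrableOn (by fun_prop) ?_
  refine (ae_restrict_iff' measurableSet_Ioi).2 (ae_of_all _ fun t ht => ?_)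
  have ht' : 0 < t := ht
  rw [Real.norm_of_nonneg (by positivity)]
  gcongr
  nlinarith [mul_nonneg hw ht'.le]

lemma integrableOn_mills {w : ℝ} (hw : 0 ≤ w) :
    IntegrableOn (fun t : ℝ => exp (-w * t - t ^ 2 / 2)) (Set.Ioi 0) := by
  simpa using integrableOn_pow_mul_mills hw 0

lemma mills_nonneg (w : ℝ) : 0 ≤ mills w := integral_nonneg fun _ => (Real.exp_pos _).le

lemma integral_mul_mills {w : ℝ} (hw : 0 ≤ w) :
    ∫ t in Set.Ioi (0 : ℝ), t * exp (-w * t - t ^ 2 / 2) = 1 - w * mills w := by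
  have h1 : IntegrableOn (fun t : ℝ => t * exp (-w * t - t ^ 2 / 2)) (Set.Ioi 0) := by
    simpa using integrableOn_pow_mul_mills hw 1
  have h0 := (integrableOn_mills hw).const_mul w
  have hd : ∀ t ∈ Set.Ici (0 : ℝ), HasDerivAt (fun t : ℝ => -exp (-w * t - t ^ 2 / 2))
      (w * exp (-w * t - t ^ 2 / 2) + t * exp (-w * t - t ^ 2 / 2)) t := by
    intro t _
    have : HasDerivAt (fun t : ℝ => -w * t - t ^ 2 / 2) (-w - t) t := by
      have := ((hasDerivAt_id' t).const_mul (-w)).sub ((hasDerivAt_pow 2 t).div_const 2)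
      exact this.congr_deriv (by simp)
    exact this.exp.neg.congr_deriv (by ring)
  have hlim : Filter.Tendsto (fun t : ℝ => -exp (-w * t - t ^ 2 / 2)) Filter.atTop (nhds 0) := by
    rw [← neg_zero]
    refine (squeeze_zero' (Filter.Eventually.of_forall fun t => (Real.exp_pos _).le) ?_
      Real.tendsto_exp_neg_atTop_nhds_zero).neg
    filter_upwards [Filter.eventually_ge_atTop 2] with t ht
    gcongr
    nlinarith [mul_nonneg hw (by linarith : 0 ≤ t)]
  have key := integral_Ioi_of_hasDerivAt_of_tendsto' hd (h0.add h1) hlim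
  rw [integral_add h0 h1, integral_const_mul] at key
  simp only [mul_zero, zero_pow two_ne_zero, zero_div, sub_zero, Real.exp_zero, zero_sub,
    neg_neg] at key
  rw [mills]
  linarith

lemma mul_mills_mem_Icc {w : ℝ} (hw : 0 ≤ w) : w * mills w ∈ Set.Icc (0 : ℝ) 1 := by
  refine ⟨mul_nonneg hw (mills_nonneg w), ?_⟩
  have h : 0 ≤ ∫ t in Set.Ioi (0 : ℝ), t * exp (-w * t - t ^ 2 / 2) :=
    setIntegral_nonneg measurableSet_Ioi fun t ht => mul_nonneg (le_of_lt ht) (Real.exp_pos _).le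
  rw [integral_mul_mills hw] at h
  linarith

/-- A bound for the second derivative of the Mills ratio. -/
noncomputable def millsCurvature : ℝ := ∫ t in Set.Ioi (0 : ℝ), t ^ 2 * exp (-0 * t - t ^ 2 / 2)

lemma millsCurvature_nonneg : 0 ≤ millsCurvature :=
  integral_nonneg fun t => mul_nonneg (sq_nonneg t) (Real.exp_pos _).le

lemma abs_exp_neg_sub_le {x y : ℝ} (hx : 0 ≤ x) (hy : 0 ≤ y) :
    |exp (-y) - exp (-x)| ≤ |y - x| := by
  wlog h : x ≤ y generalizing x y
  · rw [abs_sub_comm, abs_sub_comm y]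
    exact this hy hx (le_of_not_ge h)
  have h1 : exp (-y) ≤ exp (-x) := Real.exp_le_exp.2 (by linarith)
  rw [abs_of_nonpos (by linarith), abs_of_nonneg (by linarith)]
  have h2 := Real.add_one_le_exp (x - y)
  have h3 : exp (-y) = exp (-x) * exp (x - y) := by rw [← Real.exp_add]; ring_nf
  have h4 : exp (-x) ≤ 1 := Real.exp_le_one_iff.2 (by linarith)
  have h5 := Real.exp_pos (-x)
  rw [h3]
  nlinarith

lemma abs_exp_neg_taylor_le {x y : ℝ} (hx : 0 ≤ x) (hy : 0 ≤ y) :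
    |exp (-y) - exp (-x) + (y - x) * exp (-x)| ≤ (y - x) ^ 2 := by
  have h1 := Real.add_one_le_exp (x - y)
  have h2 := Real.add_one_le_exp (y - x)
  have e1 : exp (-y) = exp (-x) * exp (x - y) := by rw [← Real.exp_add]; ring_nf
  have e2 : exp (-x) = exp (-y) * exp (y - x) := by rw [← Real.exp_add]; ring_nf
  have hx0 := Real.exp_pos (-x)
  have hy0 := Real.exp_pos (-y)
  have lower : 0 ≤ exp (-y) - exp (-x) + (y - x) * exp (-x) := by
    nlinarith
  have upper : exp (-y) - exp (-x) ≤ -(y - x) * exp (-y) := by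
    nlinarith
  rw [abs_of_nonneg lower]
  calc exp (-y) - exp (-x) + (y - x) * exp (-x) ≤ (y - x) * (exp (-x) - exp (-y)) := by linarith
    _ ≤ |(y - x)| * |exp (-x) - exp (-y)| := by rw [← abs_mul]; exact le_abs_self _
    _ ≤ |y - x| * |y - x| := by
        rw [abs_sub_comm (exp (-x))]
        exact mul_le_mul_of_nonneg_left (abs_exp_neg_sub_le hx hy) (abs_nonneg _)
    _ = (y - x) ^ 2 := by rw [← sq, sq_abs]

lemma abs_mills_taylor_le {v w : ℝ} (hv : 0 ≤ v) (hw : 0 ≤ w) :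
    |mills w - mills v - (w - v) * (v * mills v - 1)| ≤ millsCurvature * (w - v) ^ 2 := by
  have hv1 : IntegrableOn (fun t : ℝ => t * exp (-v * t - t ^ 2 / 2)) (Set.Ioi 0) := by
    simpa using integrableOn_pow_mul_mills hv 1
  have e : mills w - mills v - (w - v) * (v * mills v - 1) =
      ∫ t in Set.Ioi (0 : ℝ), (exp (-w * t - t ^ 2 / 2) - exp (-v * t - t ^ 2 / 2) +
        (w - v) * (t * exp (-v * t - t ^ 2 / 2))) := by
    have hsub : IntegrableOn
        (fun t : ℝ => exp (-w * t - t ^ 2 / 2) - exp (-v * t - t ^ 2 / 2)) (Set.Ioi 0) :=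
      (integrableOn_mills hw).sub (integrableOn_mills hv)
    rw [integral_add hsub (hv1.const_mul _),
      integral_sub (integrableOn_mills hw) (integrableOn_mills hv), integral_const_mul,
      integral_mul_mills hv, mills, mills]
    ring
  rw [e, millsCurvature, ← integral_mul_const, ← Real.norm_eq_abs]
  refine norm_integral_le_of_norm_le ((integrableOn_pow_mul_mills le_rfl 2).mul_const _) ?_
  refine (ae_restrict_iff' measurableSet_Ioi).2 (ae_of_all _ fun t ht => ?_)
  have ht' : 0 < t := ht
  have h := abs_exp_neg_taylor_le (mul_nonneg hv ht'.le) (mul_nonneg hw ht'.le)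
  have split : ∀ u : ℝ, exp (-u * t - t ^ 2 / 2) = exp (-(u * t)) * exp (-(t ^ 2 / 2)) := by
    intro u; rw [← Real.exp_add]; ring_nf
  rw [split, split, split, Real.norm_eq_abs]
  have e' : exp (-(w * t)) * exp (-(t ^ 2 / 2)) - exp (-(v * t)) * exp (-(t ^ 2 / 2)) +
      (w - v) * (t * (exp (-(v * t)) * exp (-(t ^ 2 / 2)))) =
      (exp (-(w * t)) - exp (-(v * t)) + (w * t - v * t) * exp (-(v * t))) *
        exp (-(t ^ 2 / 2)) := by ring
  rw [e', abs_mul, abs_of_pos (Real.exp_pos (-(t ^ 2 / 2)))]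
  calc _ ≤ (w * t - v * t) ^ 2 * exp (-(t ^ 2 / 2)) := by gcongr
    _ = _ := by simp; ring

lemma abs_mills_sub_le {v w : ℝ} (hv : 0 ≤ v) (hw : 0 ≤ w) : |mills w - mills v| ≤ |w - v| := by
  have hv1 : IntegrableOn (fun t : ℝ => t * exp (-0 * t - t ^ 2 / 2)) (Set.Ioi 0) := by
    simpa using integrableOn_pow_mul_mills le_rfl 1
  have hone : ∫ t in Set.Ioi (0 : ℝ), t * exp (-0 * t - t ^ 2 / 2) = 1 := by
    simpa using integral_mul_mills le_rfl
  rw [mills, mills, ← integral_sub (integrableOn_mills hw) (integrableOn_mills hv),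
    ← mul_one |w - v|, ← hone, ← integral_const_mul, ← Real.norm_eq_abs]
  refine norm_integral_le_of_norm_le (hv1.const_mul _) ?_
  refine (ae_restrict_iff' measurableSet_Ioi).2 (ae_of_all _ fun t ht => ?_)
  have ht' : 0 < t := ht
  have h := abs_exp_neg_sub_le (mul_nonneg hv ht'.le) (mul_nonneg hw ht'.le)
  have split : ∀ u : ℝ, exp (-u * t - t ^ 2 / 2) = exp (-(u * t)) * exp (-(t ^ 2 / 2)) := by
    intro u; rw [← Real.exp_add]; ring_nf
  rw [split, split, split, Real.norm_eq_abs, ← sub_mul, abs_mul,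
    abs_of_pos (Real.exp_pos (-(t ^ 2 / 2)))]
  rw [← sub_mul, abs_mul, abs_of_pos ht'] at h
  calc _ ≤ |w - v| * t * exp (-(t ^ 2 / 2)) := by gcongr
    _ = _ := by simp; ring

/-- The derivative of the Stein solution `x ↦ mills |x|`, with its left value at `0`. -/
noncomputable def steinDeriv (x : ℝ) : ℝ := x * mills |x| + if x ≤ 0 then 1 else -1

lemma abs_steinDeriv_le (x : ℝ) : |steinDeriv x| ≤ 1 := by
  obtain ⟨h0, h1⟩ := mul_mills_mem_Icc (abs_nonneg x)
  unfold steinDeriv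
  split_ifs with hx
  · rw [abs_of_nonpos hx] at h0 h1 ⊢
    rw [abs_le]; constructor <;> linarith
  · rw [abs_of_pos (not_le.1 hx)] at h0 h1 ⊢
    rw [abs_le]; constructor <;> linarith

lemma abs_stein_taylor_le {x δ : ℝ} (hδ : 0 ≤ δ) :
    |mills |x + δ| - mills |x| - δ * steinDeriv x| ≤
      millsCurvature * δ ^ 2 + if x ≤ 0 ∧ 0 < x + δ then 2 * δ else 0 := by
  unfold steinDeriv
  rcases lt_or_ge 0 x with hx | hx
  · have h := abs_mills_taylor_le hx.le (by positivity : 0 ≤ x + δ)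
    rw [if_neg (not_le.2 hx), if_neg fun h : x ≤ 0 ∧ 0 < x + δ => not_le.2 hx h.1, abs_of_pos hx,
      abs_of_pos (by positivity : 0 < x + δ)]
    convert h using 2
    · ring
    · ring
  · rcases lt_or_ge 0 (x + δ) with hxδ | hxδ
    · have h1 := abs_mills_sub_le (abs_nonneg x) (abs_nonneg (x + δ))
      have h2 : |(|x + δ| - |x|)| ≤ δ := by
        have := abs_abs_sub_abs_le (x + δ) x
        rwa [add_sub_cancel_left, abs_of_nonneg hδ] at this
      have h3 : |δ * steinDeriv x| ≤ δ := by
        rw [abs_mul, abs_of_nonneg hδ]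
        exact mul_le_of_le_one_right hδ (abs_steinDeriv_le x)
      have h4 := abs_sub (mills |x + δ| - mills |x|) (δ * steinDeriv x)
      have h5 := mul_nonneg millsCurvature_nonneg (sq_nonneg δ)
      rw [if_pos (show x ≤ 0 ∧ 0 < x + δ from ⟨hx, hxδ⟩)]
      unfold steinDeriv at h3 h4
      linarith
    · have h := abs_mills_taylor_le (by linarith : 0 ≤ -x) (by linarith : 0 ≤ -(x + δ))
      rw [if_pos hx, if_neg fun h : x ≤ 0 ∧ 0 < x + δ => not_lt.2 hxδ h.2, abs_of_nonpos hx, abs_of_nonpos hxδ]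
      convert h using 2
      · ring
      · ring

lemma sum_truncated_abs_le {p : ℝ} (hp : p ∈ Set.Ioo (0 : ℝ) 1) (n : ℕ) :
    |∑ k ∈ range (n + 1), if (k : ℝ) ≤ p * n then binWeight p n k * (k - n * p) else 0| ≤
      √(n * p * (1 - p)) := by
  refine (abs_sum_le_sum_abs _ _).trans
    ((sum_le_sum fun k _ => ?_).trans (sum_binWeight_mul_abs_sub_le hp))
  have hw := binWeight_nonneg hp n k
  split_ifs
  · rw [abs_mul, abs_of_nonneg hw]
  · rw [abs_zero]; positivity

/-- The binomial mass at the integer where the mean is crossed is of order at most `1 / σ`. -/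
lemma sum_crossing_le {p : ℝ} (hp : p ∈ Set.Ioo (0 : ℝ) 1) (n : ℕ) :
    ∑ k ∈ range (n + 1), (if (k : ℝ) ≤ p * n ∧ p * n < k + 1 then
      binWeight p n k * (p * (n - k)) else 0) ≤ √(n * p * (1 - p)) := by
  have h := binWeight_stein p n fun k => if (k : ℝ) ≤ p * n then 1 else 0
  have h1 := (abs_le.1 (sum_truncated_abs_le hp n)).1
  have e1 : ∑ k ∈ range (n + 1), (if (k : ℝ) ≤ p * n ∧ p * n < k + 1 then
      binWeight p n k * (p * (n - k)) else 0) =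
      -∑ k ∈ range (n + 1), binWeight p n k * (p * (n - k) *
        ((if ((k + 1 : ℕ) : ℝ) ≤ p * n then 1 else 0) - if (k : ℝ) ≤ p * n then 1 else 0)) := by
    rw [← sum_neg_distrib]
    refine sum_congr rfl fun k _ => ?_
    push_cast
    by_cases h1 : (k : ℝ) ≤ p * n
    · by_cases h2 : (k : ℝ) + 1 ≤ p * n
      · simp [h1, h2, not_lt.2 h2]
      · simp [h1, h2, not_le.1 h2]
    · have h2 : ¬(k : ℝ) + 1 ≤ p * n := fun h => h1 (by linarith)
      simp [h1, h2]
  have e2 : ∑ k ∈ range (n + 1), (if (k : ℝ) ≤ p * n then binWeight p n k * (k - n * p) else 0) =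
      ∑ k ∈ range (n + 1), binWeight p n k * ((k - n * p) * if (k : ℝ) ≤ p * n then 1 else 0) := by
    refine sum_congr rfl fun k _ => ?_
    split_ifs <;> ring
  rw [e1, h, ← e2]
  linarith

/-- A Berry–Esseen bound for the binomial distribution at its mean. -/
lemma abs_binCdf_sub_half_le {p : ℝ} (hp : p ∈ Set.Ioo (0 : ℝ) 1) {n : ℕ} (hn : 0 < n) :
    |binCdf p p n - 1 / 2| ≤ (3 + millsCurvature) / √(n * p * (1 - p)) := by
  have hp0 := hp.1
  have hq0 : 0 < 1 - p := by linarith [hp.2]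
  have hn' : (0 : ℝ) < n := by exact_mod_cast hn
  have hcross := sum_crossing_le hp n
  have habs := sum_binWeight_mul_abs_sub_le hp (n := n)
  set σ := √(n * p * (1 - p))
  have hσ : 0 < σ := Real.sqrt_pos.2 (by positivity)
  have hσ2 : σ ^ 2 = n * p * (1 - p) := Real.sq_sqrt (by positivity)
  set x : ℕ → ℝ := fun k => (k - n * p) / σ with hx
  have hxs : ∀ k : ℕ, σ * x k = k - n * p := fun k => by simp only [hx]; field_simp
  have hx1 : ∀ k : ℕ, x (k + 1) = x k + 1 / σ := fun k => by
    simp only [hx]; push_cast; ring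
  have hx0 : ∀ k : ℕ, x k ≤ 0 ↔ (k : ℝ) ≤ p * n := fun k => by
    simp only [hx]; rw [div_le_iff₀ hσ, zero_mul, sub_nonpos, mul_comm p]
  have hxpos : ∀ k : ℕ, 0 < x k + 1 / σ ↔ p * n < (k : ℝ) + 1 := fun k => by
    rw [← hx1, ← not_le, hx0, not_le]; push_cast; rfl
  set R : ℕ → ℝ := fun k => mills |x (k + 1)| - mills |x k| - 1 / σ * steinDeriv (x k) with hR
  have hstein := binWeight_stein p n fun k => mills |x k|
  have hsign : ∑ k ∈ range (n + 1), binWeight p n k * (if x k ≤ 0 then 1 else -1) =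
      2 * binCdf p p n - 1 := by
    conv_rhs => rw [binCdf_eq hp, ← sum_binWeight p n, mul_sum, ← sum_sub_distrib]
    refine sum_congr rfl fun k _ => ?_
    simp only [hx0]
    split_ifs <;> ring
  have hmain : σ * (2 * binCdf p p n - 1) =
      ∑ k ∈ range (n + 1), binWeight p n k * (p * x k * steinDeriv (x k)) -
        ∑ k ∈ range (n + 1), binWeight p n k * (p * (n - k) * R k) := by
    rw [← sub_eq_zero] at hstein ⊢
    refine Eq.trans ?_ hstein
    rw [← hsign, mul_sum, ← sum_sub_distrib, ← sum_sub_distrib, ← sum_sub_distrib]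
    refine sum_congr rfl fun k _ => ?_
    have hpk : p * (n - k) = σ * (σ - p * x k) := by
      linear_combination p * hxs k - hσ2
    simp only [hR, ← hxs k, hpk]
    rw [steinDeriv]
    field_simp
    ring
  have hfirst : |∑ k ∈ range (n + 1), binWeight p n k * (p * x k * steinDeriv (x k))| ≤ 1 := by
    have h1 : ∑ k ∈ range (n + 1), binWeight p n k * |x k| ≤ 1 := by
      have : ∑ k ∈ range (n + 1), binWeight p n k * |x k| =
          (∑ k ∈ range (n + 1), binWeight p n k * |(k : ℝ) - n * p|) / σ := by
        rw [sum_div]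
        refine sum_congr rfl fun k _ => ?_
        simp only [hx]; rw [abs_div, abs_of_pos hσ, mul_div_assoc]
      rw [this]
      exact div_le_one_of_le₀ habs hσ.le
    refine (abs_sum_le_sum_abs _ _).trans ((sum_le_sum fun k _ => ?_).trans h1)
    have hw := binWeight_nonneg hp n k
    rw [abs_mul, abs_of_nonneg hw, abs_mul, abs_mul, abs_of_pos hp0]
    gcongr
    have h2 := mul_le_of_le_one_left (abs_nonneg (x k)) hp.2.le
    exact (mul_le_of_le_one_right (by positivity) (abs_steinDeriv_le _)).trans h2
  have hsecond : |∑ k ∈ range (n + 1), binWeight p n k * (p * (n - k) * R k)| ≤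
      millsCurvature + 2 := by
    have hterm : ∀ k ∈ range (n + 1), |binWeight p n k * (p * (n - k) * R k)| ≤
        millsCurvature / σ ^ 2 * (binWeight p n k * (p * (n - k))) +
          2 / σ * (if (k : ℝ) ≤ p * n ∧ p * n < k + 1 then
            binWeight p n k * (p * (n - k)) else 0) := by
      intro k hk
      have hw := binWeight_nonneg hp n k
      have hkn : (0 : ℝ) ≤ n - k :=
        sub_nonneg.2 (by exact_mod_cast Nat.lt_succ_iff.1 (mem_range.1 hk))
      have hRk : |R k| ≤ _ :=
        hx1 k ▸ abs_stein_taylor_le (x := x k) (by positivity : 0 ≤ 1 / σ)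
      simp only [hx1, hx0, hxpos] at hRk
      rw [abs_mul, abs_mul, abs_of_nonneg hw, abs_of_nonneg (by positivity : 0 ≤ p * (n - k : ℝ)),
        ← mul_assoc]
      refine (mul_le_mul_of_nonneg_left hRk (by positivity)).trans (le_of_eq ?_)
      split_ifs <;> ring
    have hmean : ∑ k ∈ range (n + 1), binWeight p n k * (p * (n - k)) = σ ^ 2 := by
      have e : ∀ k : ℕ, binWeight p n k * (p * (n - k)) =
          n * p * binWeight p n k - p * (binWeight p n k * k) := fun k => by ring
      simp only [e]
      rw [sum_sub_distrib, ← mul_sum, ← mul_sum, sum_binWeight, sum_binWeight_mul_id, hσ2]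
      ring
    refine (abs_sum_le_sum_abs _ _).trans ((sum_le_sum hterm).trans ?_)
    rw [sum_add_distrib, ← mul_sum, ← mul_sum, hmean]
    have h1 := mul_le_mul_of_nonneg_left hcross (by positivity : 0 ≤ 2 / σ)
    rw [div_mul_cancel₀ _ hσ.ne'] at h1
    rw [div_mul_cancel₀ _ (by positivity)]
    linarith
  have htotal : |σ * (2 * binCdf p p n - 1)| ≤ 3 + millsCurvature := by
    rw [hmain]
    exact (abs_sub _ _).trans (by linarith)
  have e : σ * (2 * binCdf p p n - 1) = 2 * ((binCdf p p n - 1 / 2) * σ) := by ring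
  rw [e, abs_mul, abs_mul, abs_of_pos hσ, abs_two] at htotal
  rw [le_div_iff₀ hσ]
  have := mul_nonneg (abs_nonneg (binCdf p p n - 1 / 2)) hσ.le
  linarith

lemma abs_binPartialMean_sub_half_le {p : ℝ} (hp : p ∈ Set.Ioo (0 : ℝ) 1) (n : ℕ) :
    |binPartialMean p p n - n * p / 2| ≤
      √(n * p * (1 - p)) + n * p * |binCdf p p n - 1 / 2| := by
  have h := sum_truncated_abs_le hp n
  have e : ∑ k ∈ range (n + 1), (if (k : ℝ) ≤ p * n then binWeight p n k * (k - n * p) else 0) =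
      binPartialMean p p n - n * p * binCdf p p n := by
    rw [binPartialMean_eq hp, binCdf_eq hp, mul_sum, ← sum_sub_distrib]
    refine sum_congr rfl fun k _ => ?_
    split_ifs <;> ring
  rw [e] at h
  have hnp : 0 ≤ n * p := mul_nonneg n.cast_nonneg hp.1.le
  calc |binPartialMean p p n - n * p / 2| =
      |(binPartialMean p p n - n * p * binCdf p p n) + n * p * (binCdf p p n - 1 / 2)| := by
        congr 1; ring
    _ ≤ _ := (abs_add_le _ _).trans (by rw [abs_mul, abs_of_nonneg hnp]; linarith)

/-- Concentration trichotomy for the truncated binomial cdf and partial mean. -/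
theorem binomial_truncation_trichotomy (p b : ℝ) (hp : p ∈ Set.Ioo (0 : ℝ) 1)
    (hb : b ∈ Set.Ioo (0 : ℝ) 1) :
    (p < b → ∃ C c : ℝ, 0 < C ∧ 0 < c ∧ ∀ n : ℕ, 0 < n →
        1 - binCdf p b n ≤ C * Real.exp (-c * n) ∧
        |binPartialMean p b n - n * p| ≤ C * Real.exp (-c * n)) ∧
    (b = p → ∃ C : ℝ, 0 < C ∧ ∃ N : ℕ, ∀ n : ℕ, N < n →
        |binCdf p b n - 1 / 2| ≤ C / Real.sqrt n ∧
        |binPartialMean p b n - n * p / 2| ≤ C * Real.sqrt n) ∧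
    (b < p → ∃ C c : ℝ, 0 < C ∧ 0 < c ∧ ∀ n : ℕ, 0 < n →
        binCdf p b n ≤ C * Real.exp (-c * n) ∧
        binPartialMean p b n ≤ C * Real.exp (-c * n)) := by
  refine ⟨fun h => ?_, fun h => ?_, fun h => ?_⟩
  · have hc : 0 < (b - p) ^ 2 / 4 := by have := sub_pos.2 h; positivity
    exact ⟨1 + 2 / ((b - p) ^ 2 / 4), (b - p) ^ 2 / 4 / 2, by positivity, by positivity,
      fun n _ => exp_decay_half hc (one_sub_binCdf_le hp hb h n)
        (abs_binPartialMean_sub_le hp hb n)⟩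
  · subst h
    have hp0 := hp.1
    have hq0 : 0 < 1 - b := by linarith [hp.2]
    have hK := millsCurvature_nonneg
    set s := √(b * (1 - b))
    have hs0 : 0 < s := Real.sqrt_pos.2 (by positivity)
    have hσ : ∀ n : ℕ, √(n * b * (1 - b)) = √n * s := fun n => by
      rw [mul_assoc, Real.sqrt_mul n.cast_nonneg]
    refine ⟨s + (3 + millsCurvature) / s, by positivity, 0, fun n hn => ?_⟩
    have hn0 : 0 < √(n : ℝ) := Real.sqrt_pos.2 (by exact_mod_cast hn)
    have hcdf : |binCdf b b n - 1 / 2| ≤ (3 + millsCurvature) / s / √n := by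
      have := abs_binCdf_sub_half_le hp hn
      rwa [hσ, mul_comm, ← div_div] at this
    refine ⟨hcdf.trans (by gcongr; linarith), ?_⟩
    have hmean := abs_binPartialMean_sub_half_le hp n
    have hnb : n * b ≤ √n * √n := by
      rw [Real.mul_self_sqrt n.cast_nonneg]
      exact mul_le_of_le_one_right n.cast_nonneg hp.2.le
    calc |binPartialMean b b n - n * b / 2|
        ≤ √(n * b * (1 - b)) + n * b * |binCdf b b n - 1 / 2| := hmean
      _ ≤ √n * s + √n * √n * ((3 + millsCurvature) / s / √n) := by
          rw [hσ]; gcongr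
      _ = (s + (3 + millsCurvature) / s) * √n := by field_simp
  · have hc : 0 < (b - p) ^ 2 / 4 := by have := (sub_neg.2 h).ne; positivity
    exact ⟨1 + 2 / ((b - p) ^ 2 / 4), (b - p) ^ 2 / 4 / 2, by positivity, by positivity,
      fun n _ => exp_decay_half hc (binCdf_le hp hb h n) (binPartialMean_le hp hb n)⟩
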